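/- Let p be a prime, q = p^n, and let ℓ ≥ 2 and r ≥ 0 be integers with n·ℓ even. Let a, b, c ∈ F_{q^ℓ} with a ≠ 0, set f(x) = a^{q^r}·x^{q^{2r}} + a·x, and suppose there exists x₀ ∈ F_{q^ℓ} with f(x₀) = −b^{q^r} and T(a·x₀^{q^r+1} − c) = 0. Then N_{ℓ,r}(a,b,c) = q^ℓ − (q−1)·p^{nℓ/2 + nr} if and only if one of the following holds: (1′) r = 0, ℓ is even, p ≡ 1 (mod 4), and a is a square in F_{q^ℓ}; (2′) r = 0, ℓ is even, p ≡ 3 (mod 4), and either nℓ/2 is odd and a is not a square in F_{q^ℓ}, or nℓ/2 is even and a is a square in F_{q^ℓ}; (3′) r ≥ 1, 2r divides ℓ with ℓ/(2r) even, and the map x ↦ f(x) is not a bijection of F_{q^ℓ}. -/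

import Mathlib

open Finset

section FiniteFieldPowers

variable {F : Type*} [Field F] [Fintype F]

lemma exists_pow_eq_of_pow_eq_one {d e : ℕ} (hde : d * e = Fintype.card F - 1)
    {t : F} (ht : t ≠ 0) (hte : t ^ e = 1) : ∃ z : F, z ≠ 0 ∧ z ^ d = t := by
  classical
  lift t to Fˣ using (isUnit_iff_ne_zero.2 ht)
  obtain ⟨g, hg⟩ := IsCyclic.exists_generator (α := Fˣ)
  obtain ⟨k, rfl⟩ := (mem_powers_iff_mem_zpowers).2 (hg t)
  have ho : orderOf g = d * e := by
    rw [orderOf_eq_card_of_forall_mem_zpowers hg, Nat.card_eq_fintype_card, Fintype.card_units, hde]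
  have he : 0 < e := by
    rcases Nat.eq_zero_or_pos e with h | h
    · have := Fintype.one_lt_card (α := F)
      subst h; omega
    · exact h
  have h1 : (g ^ k) ^ e = 1 := by
    rw [← Units.val_inj]
    simpa using hte
  rw [← pow_mul] at h1
  have h2 := orderOf_dvd_of_pow_eq_one h1
  rw [ho] at h2
  obtain ⟨j, rfl⟩ := Nat.dvd_of_mul_dvd_mul_right he h2
  exact ⟨(g ^ j : Fˣ), Units.ne_zero _, by push_cast; rw [← pow_mul, mul_comm]⟩

variable [DecidableEq F]

lemma card_units_pow_eq_one (d : ℕ) :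
    #{u : Fˣ | u ^ d = 1} = (Fintype.card F - 1).gcd d := by
  rw [← Fintype.card_units, ← Nat.card_eq_fintype_card, ← IsCyclic.card_powMonoidHom_ker]
  exact (Nat.subtype_card _ fun u => by simp [MonoidHom.mem_ker]).symm

lemma card_pow_eq_self {Q : ℕ} (hQ : 1 ≤ Q) :
    #{x : F | x ^ Q = x} = (Fintype.card F - 1).gcd (Q - 1) + 1 := by
  rw [← card_units_pow_eq_one]
  have h : ({x : F | x ^ Q = x} : Finset F)
      = insert 0 (({u : Fˣ | u ^ (Q - 1) = 1} : Finset Fˣ).map ⟨Units.val, Units.val_injective⟩) := by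
    obtain ⟨k, rfl⟩ := Nat.exists_eq_add_of_le' hQ
    ext x
    by_cases hx : x = 0
    · simp [hx]
    · lift x to Fˣ using (isUnit_iff_ne_zero.2 hx)
      simp only [mem_filter, mem_univ, true_and, mem_insert, hx, false_or, mem_map,
        Function.Embedding.coeFn_mk, Units.val_inj, exists_eq_right, Nat.add_sub_cancel]
      rw [← Units.val_pow_eq_pow_val, Units.val_inj, pow_succ, mul_eq_right]
  rw [h, card_insert_of_notMem (by simp), card_map]

lemma exists_sum_pow_eq_add_mul {d : ℕ} (hd : 1 ≤ d) (hdvd : d ∣ Fintype.card F - 1) (h : F → ℂ)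
    (hint : ∀ x, IsIntegral ℤ (h x)) :
    ∃ z : ℂ, IsIntegral ℤ z ∧ ∑ x, h (x ^ d) = h 0 + d * z := by
  have h1 : ∑ x, h (x ^ d) = h 0 + ∑ u : Fˣ, h ((u ^ d : Fˣ) : F) := by
    have huniv : (univ : Finset F)
        = insert 0 ((univ : Finset Fˣ).map ⟨Units.val, Units.val_injective⟩) := by
      ext x
      by_cases hx : x = 0
      · simp [hx]
      · lift x to Fˣ using (isUnit_iff_ne_zero.2 hx)
        simp
    rw [huniv, sum_insert (by simp), sum_map, zero_pow (by omega)]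
    simp
  refine ⟨∑ v ∈ univ.image (fun u : Fˣ => u ^ d), h v, IsIntegral.sum _ fun v _ => hint _, ?_⟩
  rw [h1, sum_comp (fun v : Fˣ => h v) (fun u : Fˣ => u ^ d), mul_sum]
  congr 1
  refine sum_congr rfl fun v hv => ?_
  obtain ⟨w, -, rfl⟩ := mem_image.1 hv
  have h2 := MonoidHom.card_fiber_eq_of_mem_range (powMonoidHom d : Fˣ →* Fˣ)
    (x := w ^ d) (y := 1) ⟨w, rfl⟩ ⟨1, by simp⟩
  simp only [powMonoidHom_apply] at h2
  rw [h2, card_units_pow_eq_one, Nat.gcd_eq_right hdvd, nsmul_eq_mul]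

lemma card_twisted_ker {a x₀ : F} {Q : ℕ} (hx₀ : x₀ ≠ 0) (ha : a ≠ 0)
    (h0 : a ^ Q * x₀ ^ (Q ^ 2) + a * x₀ = 0) :
    #{x : F | a ^ Q * x ^ (Q ^ 2) + a * x = 0} = #{x : F | x ^ (Q ^ 2) = x} := by
  symm
  refine card_bij' (fun x _ => x₀ * x) (fun x _ => x₀⁻¹ * x) ?_ ?_ ?_ ?_
  · intro x hx
    simp only [mem_filter, mem_univ, true_and] at hx ⊢
    rw [mul_pow, hx]
    linear_combination x * h0
  · intro x hx
    simp only [mem_filter, mem_univ, true_and] at hx ⊢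
    rw [mul_pow, inv_pow]
    have h4 : a ^ Q ≠ 0 := pow_ne_zero _ ha
    have h5 : x₀ ^ (Q ^ 2) ≠ 0 := pow_ne_zero _ hx₀
    field_simp
    apply mul_left_cancel₀ h4
    apply mul_left_cancel₀ ha
    linear_combination a * x₀ * hx - a * x * h0
  · intro x _; field_simp
  · intro x _; field_simp

end FiniteFieldPowers

section CharacterSums

variable {F : Type*} [Field F]

lemma pow_pow_eq_self {q : ℕ} {t : F} (ht : t ^ q = t) (k : ℕ) : t ^ q ^ k = t := by
  induction k with
  | zero => simp
  | succ k ih => rw [pow_succ, pow_mul, ih, ht]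

lemma add_pow_pow_of_add_pow {q : ℕ} (hadd : ∀ x y : F, (x + y) ^ q = x ^ q + y ^ q) (k : ℕ)
    (x y : F) : (x + y) ^ q ^ k = x ^ q ^ k + y ^ q ^ k := by
  induction k with
  | zero => simp
  | succ k ih => rw [pow_succ, pow_mul, ih, hadd, ← pow_mul, ← pow_mul]

lemma addChar_pow_pow {χ : AddChar F ℂ} {q : ℕ} (hχ : ∀ x, χ (x ^ q) = χ x) (k : ℕ) (x : F) :
    χ (x ^ q ^ k) = χ x := by
  induction k with
  | zero => simp
  | succ k ih => rw [pow_succ, pow_mul, hχ, ih]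

variable [Fintype F]

lemma bijective_pow_of_add_pow {Q : ℕ} (hQ : 1 ≤ Q)
    (hadd : ∀ x y : F, (x + y) ^ Q = x ^ Q + y ^ Q) :
    Function.Bijective (fun x : F => x ^ Q) := by
  refine Finite.injective_iff_bijective.1 fun x y hxy => ?_
  replace hxy : x ^ Q = y ^ Q := hxy
  have h := hadd (x - y) y
  simp only [sub_add_cancel] at h
  rw [hxy, right_eq_add] at h
  exact sub_eq_zero.1 (pow_eq_zero_iff (by omega) |>.1 h)

lemma exists_trace_ne_zero {q ℓ : ℕ} (hq : 2 ≤ q) (hℓ : 1 ≤ ℓ) (hF : Fintype.card F = q ^ ℓ) :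
    ∃ z : F, ∑ i ∈ range ℓ, z ^ q ^ i ≠ 0 := by
  by_contra! h
  obtain ⟨m, rfl⟩ := Nat.exists_eq_add_of_le' hℓ
  set P : Polynomial F := ∑ i ∈ range (m + 1), Polynomial.X ^ q ^ i with hP
  have hdeg : P.natDegree ≤ q ^ m := by
    refine Polynomial.natDegree_sum_le_of_forall_le _ _ fun i hi => ?_
    rw [Polynomial.natDegree_X_pow]
    exact Nat.pow_le_pow_right (by omega) (by simpa [Nat.lt_succ_iff] using hi)
  have h0 : P = 0 := by
    refine Polynomial.eq_zero_of_natDegree_lt_card_of_eval_eq_zero P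
      (f := fun x : F => x) Function.injective_id (fun x => ?_) ?_
    · simpa [hP, Polynomial.eval_finsetSum] using h x
    · rw [hF]
      exact hdeg.trans_lt (Nat.pow_lt_pow_right (by omega) (by omega))
  have h1 : P.coeff 1 = 1 := by
    rw [hP, Polynomial.finsetSum_coeff, sum_eq_single 0]
    · simp
    · intro i _ hi
      rw [Polynomial.coeff_X_pow, if_neg]
      exact (Nat.one_lt_pow hi (by omega)).ne
    · simp
  simp [h0] at h1

/-- A nontrivial additive character factoring through the trace to the fixed field of `x ↦ x ^ q`. -/
lemma exists_addChar_trace {q ℓ : ℕ} (hq : 2 ≤ q) (hℓ : 1 ≤ ℓ) (hF : Fintype.card F = q ^ ℓ)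
    (hadd : ∀ x y : F, (x + y) ^ q = x ^ q + y ^ q) :
    ∃ χ : AddChar F ℂ, χ ≠ 1 ∧ (∀ x, χ (x ^ q) = χ x) ∧
      ∀ z, ∑ i ∈ range ℓ, z ^ q ^ i = 0 → ∀ t, t ^ q = t → χ (t * z) = 1 := by
  obtain ⟨ψ, hψ⟩ := AddChar.exists_apply_ne_zero.2 (one_ne_zero (α := F))
  let T : F →+ F :=
    { toFun := fun z => ∑ i ∈ range ℓ, z ^ q ^ i
      map_zero' := sum_eq_zero fun i _ => zero_pow (by positivity)
      map_add' := fun x y => by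
        rw [← sum_add_distrib]
        exact sum_congr rfl fun i _ => add_pow_pow_of_add_pow hadd i x y }
  have hT : ∀ z, T z = ∑ i ∈ range ℓ, z ^ q ^ i := fun _ => rfl
  have hTq : ∀ z, T (z ^ q) = T z := by
    intro z
    have h1 := sum_range_succ (fun i => z ^ q ^ i) ℓ
    rw [sum_range_succ', ← hF, FiniteField.pow_card, pow_zero, pow_one, add_left_inj] at h1
    rw [hT, hT, ← h1]
    exact sum_congr rfl fun i _ => by rw [← pow_mul, pow_succ']
  have hTmul : ∀ t, t ^ q = t → ∀ z, T (t * z) = t * T z := by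
    intro t ht z
    rw [hT, hT, mul_sum]
    exact sum_congr rfl fun i _ => by rw [mul_pow, pow_pow_eq_self ht]
  obtain ⟨z₀, hz₀ : T z₀ ≠ 0⟩ := exists_trace_ne_zero hq hℓ hF
  have hpowT : ∀ z, T z ^ q = T z := by
    intro z
    let φ : F →+ F :=
      { toFun := fun z => z ^ q
        map_zero' := zero_pow (by omega)
        map_add' := hadd }
    have : φ (T z) = T (z ^ q) := by
      rw [hT, map_sum, hT]
      exact sum_congr rfl fun i _ => by
        change (z ^ q ^ i) ^ q = _
        rw [← pow_mul, ← pow_mul, mul_comm]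
    rw [hTq] at this
    exact this
  refine ⟨ψ.compAddMonoidHom T, ?_, ?_, ?_⟩
  · rw [AddChar.ne_one_iff]
    refine ⟨(T z₀)⁻¹ * z₀, ?_⟩
    rw [AddChar.compAddMonoidHom_apply, hTmul _ (by rw [inv_pow, hpowT]), inv_mul_cancel₀ hz₀]
    exact hψ
  · intro x
    rw [AddChar.compAddMonoidHom_apply, AddChar.compAddMonoidHom_apply, hTq]
  · intro z hz t ht
    rw [AddChar.compAddMonoidHom_apply, hTmul t ht, hT, hz, mul_zero, AddChar.map_zero_eq_one]

/-- The character sum `∑ χ(c x^(Q+1))`. -/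
noncomputable def powSum (χ : AddChar F ℂ) (Q : ℕ) (c : F) : ℂ := ∑ x, χ (c * x ^ (Q + 1))

lemma powSum_mul_pow (χ : AddChar F ℂ) (Q : ℕ) (c : F) {z : F} (hz : z ≠ 0) :
    powSum χ Q (c * z ^ (Q + 1)) = powSum χ Q c := by
  unfold powSum
  rw [← Equiv.sum_comp (Equiv.mulLeft₀ z hz) (fun x => χ (c * x ^ (Q + 1)))]
  exact sum_congr rfl fun x _ => by simp [mul_pow, mul_assoc]

lemma conj_powSum (χ : AddChar F ℂ) (Q : ℕ) (c : F) :
    starRingEnd ℂ (powSum χ Q c) = powSum χ Q (-c) := by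
  simp only [powSum, map_sum, neg_mul, AddChar.map_neg_eq_conj]

lemma sum_addChar_translate {χ : AddChar F ℂ} {Q : ℕ}
    (hadd : ∀ x y : F, (x + y) ^ Q = x ^ Q + y ^ Q) (hχ : ∀ x, χ (x ^ Q) = χ x)
    {a b c x₀ t : F} (ht : t ^ Q = t) (hx₀ : a ^ Q * x₀ ^ Q ^ 2 + a * x₀ = -(b ^ Q))
    (hc : χ (t * (a * x₀ ^ (Q + 1) - c)) = 1) :
    ∑ x, χ (t * (a * x ^ (Q + 1) + b * x + c)) = powSum χ Q (t * a) := by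
  have hlin : ∀ x, χ (t * (a * x ^ Q * x₀ + a * x * x₀ ^ Q + b * x)) = 1 := by
    intro x
    have e1 : t * (a * x ^ Q * x₀ + a * x * x₀ ^ Q + b * x)
        = t * a * x ^ Q * x₀ + t * (a * x * x₀ ^ Q + b * x) := by ring
    have e2 : t * a * x ^ Q * x₀ + (t * (a * x * x₀ ^ Q + b * x)) ^ Q = 0 := by
      rw [mul_pow, hadd, mul_pow, mul_pow, mul_pow, ← pow_mul, ← sq, ht]
      linear_combination t * x ^ Q * hx₀
    rw [e1, AddChar.map_add_eq_mul, ← hχ (t * (a * x * x₀ ^ Q + b * x)),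
      ← AddChar.map_add_eq_mul, e2, AddChar.map_zero_eq_one]
  unfold powSum
  rw [← Equiv.sum_comp (Equiv.addRight x₀)]
  refine sum_congr rfl fun x _ => ?_
  have e3 : t * (a * (x + x₀) ^ (Q + 1) + b * (x + x₀) + c)
      + t * (a * x₀ ^ (Q + 1) - c)
      = t * a * x ^ (Q + 1) + (t * (a * x ^ Q * x₀ + a * x * x₀ ^ Q + b * x)
        + t * (a * x₀ ^ Q * x₀ + a * x₀ * x₀ ^ Q + b * x₀)) := by
    rw [pow_succ, hadd]; ring
  have h := congrArg χ e3
  rw [AddChar.map_add_eq_mul, AddChar.map_add_eq_mul, AddChar.map_add_eq_mul, hlin, hlin, hc] at h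
  simpa using h

variable [DecidableEq F]

lemma card_artinSchreier {χ : AddChar F ℂ} (hχ1 : χ ≠ 1) {q : ℕ} (hq : 1 ≤ q)
    (hadd : ∀ x y : F, (x + y) ^ q = x ^ q + y ^ q) (hχ : ∀ x, χ (x ^ q) = χ x) (g : F → F) :
    (Nat.card {xy : F × F // xy.2 ^ q - xy.2 = g xy.1} : ℂ)
      = ∑ t : F with t ^ q = t, ∑ x, χ (t * g x) := by
  have hprim : χ.IsPrimitive := AddChar.IsPrimitive.of_ne_one hχ1
  have hcard : (Fintype.card F : ℂ) ≠ 0 := by simp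
  have key : ∀ z : F, (Fintype.card F : ℂ) * #{y : F | y ^ q - y = z}
      = Fintype.card F * ∑ t : F with t ^ q = t, χ (t * z) := by
    intro z
    have h1 : ∑ y : F, ∑ t : F, χ (t * (z - (y ^ q - y)))
        = (Fintype.card F : ℂ) * #{y : F | y ^ q - y = z} := by
      simp_rw [AddChar.sum_mulShift _ hprim, sub_eq_zero]
      push_cast
      rw [← sum_filter, sum_const, nsmul_eq_mul, mul_comm]
      simp_rw [eq_comm]
    have h2 : ∀ t : F, ∑ y : F, χ (t * (z - (y ^ q - y)))
        = if t ^ q = t then (Fintype.card F : ℂ) * χ (t * z) else 0 := by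
      intro t
      have h3 : ∀ y, χ (t * (z - (y ^ q - y))) = χ (t * z) * χ (y ^ q * (t ^ q - t)) := by
        intro y
        have e1 : t * (z - (y ^ q - y)) = t * z + (t * y + -(t * y ^ q)) := by ring
        have e2 : y ^ q * (t ^ q - t) = (t * y) ^ q + -(t * y ^ q) := by rw [mul_pow]; ring
        rw [e1, e2, AddChar.map_add_eq_mul, AddChar.map_add_eq_mul, AddChar.map_add_eq_mul, hχ]
      simp_rw [h3]
      rw [← mul_sum, (bijective_pow_of_add_pow hq hadd).sum_comp (fun y => χ (y * (t ^ q - t))),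
        AddChar.sum_mulShift _ hprim]
      simp only [sub_eq_zero]
      split_ifs <;> simp [mul_comm]
    rw [← h1, sum_comm, sum_congr rfl fun t _ => h2 t, ← sum_filter, mul_sum]
  rw [sum_comm]
  rw [← sum_congr rfl fun x _ => mul_left_cancel₀ hcard (key (g x))]
  rw [← Nat.cast_sum, Nat.card_eq_fintype_card, Fintype.card_subtype]
  congr 1
  rw [card_filter, Fintype.sum_prod_type]
  exact sum_congr rfl fun x _ => (card_filter _ _).symm

lemma powSum_mul_powSum_neg {χ : AddChar F ℂ} (hχ1 : χ ≠ 1) {Q : ℕ} (hQ : 1 ≤ Q)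
    (hadd : ∀ x y : F, (x + y) ^ Q = x ^ Q + y ^ Q) (hχ : ∀ x, χ (x ^ Q) = χ x) (c : F) :
    powSum χ Q c * powSum χ Q (-c) = Fintype.card F *
      ∑ x : F with c ^ Q * x ^ (Q ^ 2) + c * x = 0, χ (c * x ^ (Q + 1)) := by
  have hprim : χ.IsPrimitive := AddChar.IsPrimitive.of_ne_one hχ1
  have h1 : ∀ x y : F, χ (c * (x + y) ^ (Q + 1)) * χ (-c * y ^ (Q + 1))
      = χ (c * x ^ (Q + 1)) * χ (y ^ Q * (c ^ Q * x ^ (Q ^ 2) + c * x)) := by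
    intro x y
    have e1 : c * (x + y) ^ (Q + 1) = c * x ^ (Q + 1) + (c * x ^ Q * y + c * x * y ^ Q)
        + c * y ^ (Q + 1) := by
      rw [pow_succ, hadd]; ring
    have e2 : y ^ Q * (c ^ Q * x ^ (Q ^ 2) + c * x) = (c * x ^ Q * y) ^ Q + c * x * y ^ Q := by
      rw [mul_pow, mul_pow, ← pow_mul, sq]; ring
    rw [e1, e2, neg_mul, AddChar.map_add_eq_mul, AddChar.map_add_eq_mul, AddChar.map_add_eq_mul,
      AddChar.map_add_eq_mul, hχ, mul_assoc, ← AddChar.map_add_eq_mul _ (c * y ^ (Q + 1)),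
      add_neg_cancel, AddChar.map_zero_eq_one, mul_one]
  have h2 : powSum χ Q c * powSum χ Q (-c)
      = ∑ x : F, ∑ y : F, χ (c * (x + y) ^ (Q + 1)) * χ (-c * y ^ (Q + 1)) := by
    rw [sum_comm]
    unfold powSum
    rw [mul_sum]
    refine sum_congr rfl fun y _ => ?_
    rw [← Equiv.sum_comp (Equiv.addRight y) (fun x => χ (c * x ^ (Q + 1))), sum_mul]
    rfl
  rw [h2, mul_sum, sum_filter]
  refine sum_congr rfl fun x _ => ?_
  simp_rw [h1]
  rw [← mul_sum, (bijective_pow_of_add_pow hQ hadd).sum_comp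
    (fun y => χ (y * (c ^ Q * x ^ (Q ^ 2) + c * x))), AddChar.sum_mulShift _ hprim]
  split_ifs <;> simp [mul_comm]

lemma norm_powSum_sq_le {χ : AddChar F ℂ} (hχ1 : χ ≠ 1) {Q : ℕ} (hQ : 1 ≤ Q)
    (hadd : ∀ x y : F, (x + y) ^ Q = x ^ Q + y ^ Q) (hχ : ∀ x, χ (x ^ Q) = χ x) (c : F) :
    ‖powSum χ Q c‖ ^ 2 ≤ Fintype.card F * #{x : F | c ^ Q * x ^ (Q ^ 2) + c * x = 0} := by
  have h := powSum_mul_powSum_neg hχ1 hQ hadd hχ c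
  rw [← conj_powSum] at h
  have h' := congrArg norm h
  rw [norm_mul, RCLike.norm_conj, ← sq, norm_mul, Complex.norm_natCast] at h'
  rw [h']
  gcongr
  refine (norm_sum_le _ _).trans ?_
  simp [AddChar.norm_apply]

end CharacterSums

section SumValues

lemma sum_range_two_mul_mul_eq_zero {M : Type*} [AddCommGroup M] {f : ℕ → M} {r : ℕ}
    (hf : ∀ i, f (i + r) = -f i) (m : ℕ) : ∑ i ∈ range (2 * r * m), f i = 0 := by
  induction m with
  | zero => simp
  | succ m ih =>
    rw [mul_add, mul_one, sum_range_add, ih, two_mul, sum_range_add, zero_add,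
      ← sum_add_distrib]
    refine sum_eq_zero fun i _ => ?_
    rw [show (r + r) * m + (r + i) = (r + r) * m + i + r by ring, hf, add_neg_cancel]

lemma exists_int_of_isIntegral_of_mul_eq {z : ℂ} (hz : IsIntegral ℤ z) {d n : ℤ} (hd : d ≠ 0)
    (h : (d : ℂ) * z = n) : d ∣ n := by
  have hd' : (d : ℂ) ≠ 0 := by exact_mod_cast hd
  have hz' : z = algebraMap ℚ ℂ (n / d) := by
    rw [map_div₀, map_intCast, map_intCast, ← h, mul_div_cancel_left₀ _ hd']
  rw [hz', isIntegral_algebraMap_iff (algebraMap ℚ ℂ).injective, IsIntegrallyClosed.isIntegral_iff]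
    at hz
  obtain ⟨k, hk⟩ := hz
  refine ⟨k, ?_⟩
  have hd'' : (d : ℚ) ≠ 0 := by exact_mod_cast hd
  rw [eq_div_iff hd''] at hk
  have : k * d = n := by
    rw [eq_intCast] at hk
    exact_mod_cast hk
  rw [← this, mul_comm]

variable {F : Type*} [Field F] [Fintype F]

lemma isIntegral_addChar (χ : AddChar F ℂ) (x : F) : IsIntegral ℤ (χ x) := by
  refine IsIntegral.of_pow (n := Fintype.card F) Fintype.card_pos ?_
  rw [← AddChar.map_nsmul_eq_pow, card_nsmul_eq_zero, AddChar.map_zero_eq_one]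
  exact isIntegral_one

lemma neg_one_pow_of_add_pow {R : Type*} [Ring R] {Q : ℕ} (hQ : 1 ≤ Q)
    (hadd : ∀ x y : R, (x + y) ^ Q = x ^ Q + y ^ Q) : (-1 : R) ^ Q = -1 := by
  have h := hadd (-1) 1
  rw [neg_add_cancel, zero_pow (by omega), one_pow] at h
  exact eq_neg_of_add_eq_zero_left h.symm

lemma exists_pow_succ_eq {Q m : ℕ} (hQ : 1 ≤ Q) (hF : Fintype.card F = (Q ^ 2) ^ m)
    {t : F} (ht : t ≠ 0) (htQ : t ^ Q = t) : ∃ z : F, z ≠ 0 ∧ z ^ (Q + 1) = t := by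
  obtain ⟨k, rfl⟩ := Nat.exists_eq_add_of_le' hQ
  obtain ⟨j, hj⟩ := Nat.sub_one_dvd_pow_sub_one ((k + 1) ^ 2) m
  refine exists_pow_eq_of_pow_eq_one (e := k * j) ?_ ht ?_
  · rw [hF, hj, ← mul_assoc]
    congr 1
    rw [show (k + 1) ^ 2 = (k + 1 + 1) * k + 1 by ring, Nat.add_sub_cancel]
  · rw [pow_succ, mul_eq_right₀ ht] at htQ
    rw [pow_mul, htQ, one_pow]

variable [DecidableEq F]

lemma powSum_eq_of_mem_ker {χ : AddChar F ℂ} (hχ1 : χ ≠ 1) {Q m : ℕ} (hQ : 2 ≤ Q)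
    (hadd : ∀ x y : F, (x + y) ^ Q = x ^ Q + y ^ Q) (hχ : ∀ x, χ (x ^ Q) = χ x)
    (hF : Fintype.card F = (Q ^ 2) ^ m) (hanti : ∀ w, w ^ Q = -w → χ w = 1)
    {a x₀ : F} (ha : a ≠ 0) (hx₀ : x₀ ≠ 0) (hker : a ^ Q * x₀ ^ Q ^ 2 + a * x₀ = 0) :
    powSum χ Q a = (-1) ^ (m + 1) * (Q : ℂ) ^ (m + 1) := by
  have hQ1 : 1 ≤ Q := by omega
  have hneg : powSum χ Q (-a) = powSum χ Q a := by
    obtain ⟨z, hz, hz1⟩ := exists_pow_succ_eq hQ1 hF (neg_ne_zero.2 one_ne_zero)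
      (neg_one_pow_of_add_pow hQ1 hadd)
    rw [← powSum_mul_pow χ Q a hz, hz1, mul_neg_one]
  have hcard : #{x : F | a ^ Q * x ^ Q ^ 2 + a * x = 0} = Q ^ 2 := by
    have hQ2 : 1 ≤ Q ^ 2 := Nat.one_le_pow _ _ hQ1
    rw [card_twisted_ker hx₀ ha hker, card_pow_eq_self hQ2, hF,
      Nat.gcd_eq_right (Nat.sub_one_dvd_pow_sub_one _ _), Nat.sub_add_cancel hQ2]
  have hsq : powSum χ Q a ^ 2 = ((Q : ℂ) ^ (m + 1)) ^ 2 := by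
    have h := powSum_mul_powSum_neg hχ1 hQ1 hadd hχ a
    rw [hneg, ← sq] at h
    rw [h, sum_congr rfl (g := fun _ => (1 : ℂ)), sum_const, hcard, hF]
    · push_cast; rw [nsmul_eq_mul]; push_cast; ring
    · intro x hx
      simp only [mem_filter, mem_univ, true_and] at hx
      apply hanti
      rw [mul_pow, ← pow_mul, mul_comm (Q + 1), mul_add, ← sq, mul_one, pow_add, pow_succ]
      linear_combination x ^ Q * hx
  obtain ⟨z, hz, hSz⟩ := exists_sum_pow_eq_add_mul (d := Q + 1) (by omega)
    (show Q + 1 ∣ Fintype.card F - 1 by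
      rw [hF]
      refine dvd_trans ⟨Q - 1, ?_⟩ (Nat.sub_one_dvd_pow_sub_one (Q ^ 2) m)
      simpa using Nat.sq_sub_sq Q 1) (fun x => χ (a * x)) (fun x => isIntegral_addChar χ _)
  rw [mul_zero, AddChar.map_zero_eq_one] at hSz
  change powSum χ Q a = _ at hSz
  have hcongr : ∀ s : ℤ, powSum χ Q a = s * (Q : ℂ) ^ (m + 1) →
      ((Q : ℤ) + 1) ∣ s * (-1) ^ (m + 1) - 1 := by
    intro s hs
    have h1 : ((Q : ℤ) + 1) ∣ s * (Q : ℤ) ^ (m + 1) - 1 := by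
      refine exists_int_of_isIntegral_of_mul_eq hz (by omega) ?_
      push_cast
      rw [← hs, hSz]
      push_cast
      ring
    have h2 : ((Q : ℤ) + 1) ∣ (Q : ℤ) ^ (m + 1) - (-1) ^ (m + 1) := by
      simpa using sub_dvd_pow_sub_pow (Q : ℤ) (-1) (m + 1)
    have h3 := dvd_sub h1 (h2.mul_left s)
    rwa [show s * (Q : ℤ) ^ (m + 1) - 1 - s * ((Q : ℤ) ^ (m + 1) - (-1) ^ (m + 1))
      = s * (-1) ^ (m + 1) - 1 by ring] at h3
  have hnot : ¬ ((Q : ℤ) + 1 ∣ -2) := by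
    intro h
    have := Int.le_of_dvd (by norm_num) (Int.dvd_neg.1 h)
    omega
  rcases sq_eq_sq_iff_eq_or_eq_neg.1 hsq with h | h <;>
    rcases Nat.even_or_odd (m + 1) with hpar | hpar
  · rw [hpar.neg_one_pow, one_mul, h]
  · have := hcongr 1 (by simpa using h)
    rw [hpar.neg_one_pow] at this
    exact absurd (by simpa using this) hnot
  · have := hcongr (-1) (by simpa using h)
    rw [hpar.neg_one_pow] at this
    exact absurd (by simpa using this) hnot
  · rw [hpar.neg_one_pow, h, neg_one_mul]

lemma powSum_one_of_anti {χ : AddChar F ℂ} (hχ1 : χ ≠ 1) {P : ℕ} (hP : 1 ≤ P)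
    (h2 : (2 : F) ≠ 0) (hadd : ∀ x y : F, (x + y) ^ P = x ^ P + y ^ P)
    (hχ : ∀ x, χ (x ^ P) = χ x) (hF : Fintype.card F = P ^ 2) {w : F} (hw : w ≠ 0)
    (hwP : w ^ P = -w) : powSum χ 1 w = P := by
  have hprim : χ.IsPrimitive := AddChar.IsPrimitive.of_ne_one hχ1
  have hcard : (Fintype.card F : ℂ) ≠ 0 := by simp
  have hneg : ∀ x : F, (-x) ^ P = -x ^ P := fun x => by
    rw [neg_pow, neg_one_pow_of_add_pow hP hadd, neg_one_mul]
  have hanti : ∀ v : F, v ^ P = -v → χ v = 1 := by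
    intro v hv
    have e : (v / 2) ^ P = -(v / 2) := by
      have h2P : (2 : F) ^ P = 2 := by
        rw [← one_add_one_eq_two, hadd, one_pow]
      rw [div_pow, hv, h2P, neg_div]
    have h3 : χ (v / 2) = χ (-(v / 2)) := by rw [← hχ (v / 2), e]
    have : NeZero (2 : F) := ⟨h2⟩
    rw [← add_halves v, AddChar.map_add_eq_mul]
    nth_rewrite 2 [h3]
    rw [← AddChar.map_add_eq_mul, add_neg_cancel, AddChar.map_zero_eq_one]
  have hPP : ∀ y : F, (y ^ P) ^ P = y := fun y => by
    rw [← pow_mul, ← sq, ← hF, FiniteField.pow_card]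
  have h1 : ∀ x y : F, χ (w * (x + (y + y ^ P)) ^ (1 + 1))
      = χ (w * x ^ 2) * χ (y ^ P * (2 * w * (x - x ^ P))) := by
    intro x y
    have hu : χ (w * (y + y ^ P) ^ 2) = 1 := by
      apply hanti
      rw [mul_pow, hwP, ← pow_mul, mul_comm 2 P, pow_mul, hadd, hPP, add_comm, neg_mul]
    have e1 : w * (x + (y + y ^ P)) ^ (1 + 1) = w * x ^ 2 + (2 * w * x * y + 2 * w * x * y ^ P)
        + w * (y + y ^ P) ^ 2 := by ring
    have e2 : y ^ P * (2 * w * (x - x ^ P)) = (2 * w * x * y) ^ P + 2 * w * x * y ^ P := by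
      have h2P : (2 : F) ^ P = 2 := by
        rw [← one_add_one_eq_two, hadd, one_pow]
      rw [mul_pow, mul_pow, mul_pow, hwP, h2P]; ring
    rw [e1, e2, AddChar.map_add_eq_mul, AddChar.map_add_eq_mul, AddChar.map_add_eq_mul,
      AddChar.map_add_eq_mul, hχ, hu, mul_one]
  have hfix : #{x : F | x ^ P = x} = P := by
    rw [card_pow_eq_self hP, hF, Nat.gcd_eq_right (Nat.sub_one_dvd_pow_sub_one P 2),
      Nat.sub_add_cancel hP]
  apply mul_left_cancel₀ hcard
  calc (Fintype.card F : ℂ) * powSum χ 1 w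
      = ∑ y : F, ∑ x : F, χ (w * (x + (y + y ^ P)) ^ (1 + 1)) := by
        rw [← nsmul_eq_mul, ← card_univ, ← sum_const]
        exact sum_congr rfl fun y _ =>
          (Equiv.sum_comp (Equiv.addRight (y + y ^ P)) (fun x => χ (w * x ^ (1 + 1)))).symm
    _ = ∑ x : F, χ (w * x ^ 2) * ∑ y : F, χ (y ^ P * (2 * w * (x - x ^ P))) := by
        rw [sum_comm]
        simp_rw [h1, mul_sum]
    _ = ∑ x : F with x ^ P = x, (Fintype.card F : ℂ) := by
        rw [sum_filter]
        refine sum_congr rfl fun x _ => ?_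
        rw [(bijective_pow_of_add_pow hP hadd).sum_comp
          (fun y => χ (y * (2 * w * (x - x ^ P)))), AddChar.sum_mulShift _ hprim]
        by_cases hx : x ^ P = x
        · have : χ (w * x ^ 2) = 1 := by
            apply hanti
            rw [mul_pow, hwP, ← pow_mul, mul_comm 2 P, pow_mul, hx, neg_mul]
          simp [hx, this]
        · have : 2 * w * (x - x ^ P) ≠ 0 :=
            mul_ne_zero (mul_ne_zero h2 hw) (sub_ne_zero.2 (Ne.symm hx))
          simp [hx, this]
    _ = (Fintype.card F : ℂ) * P := by
        rw [sum_const, hfix, nsmul_eq_mul, mul_comm]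

lemma exists_powSum_one_eq_quadraticChar_mul {χ : AddChar F ℂ} (hχ1 : χ ≠ 1)
    (h2 : ringChar F ≠ 2) : ∃ G : ℂ, ∀ c : F, c ≠ 0 → powSum χ 1 c = quadraticChar F c * G := by
  have hprim : χ.IsPrimitive := AddChar.IsPrimitive.of_ne_one hχ1
  refine ⟨∑ y, (quadraticChar F y : ℂ) * χ y, fun c hc => ?_⟩
  have h1 : powSum χ 1 c = ∑ y, (quadraticChar F y : ℂ) * χ (c * y) := by
    have h3 : ∑ y : F, χ (c * y) = 0 := by
      simp_rw [mul_comm c]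
      rw [AddChar.sum_mulShift _ hprim, if_neg hc, Nat.cast_zero]
    have h4 : powSum χ 1 c = ∑ y, ((quadraticChar F y : ℂ) + 1) * χ (c * y) := by
      unfold powSum
      rw [← sum_fiberwise (g := fun x : F => x ^ 2)]
      refine sum_congr rfl fun y _ => ?_
      have h5 := quadraticChar_card_sqrts h2 y
      have h6 : (#{x : F | x ^ 2 = y} : ℂ) = (quadraticChar F y : ℂ) + 1 := by
        have : (#{x : F | x ^ 2 = y} : ℤ) = quadraticChar F y + 1 := by
          rw [← h5]; congr 2; ext x; simp
        exact_mod_cast this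
      rw [← h6, ← nsmul_eq_mul, ← sum_const]
      exact sum_congr rfl fun x hx => by rw [← (mem_filter.1 hx).2]
    rw [h4]
    simp_rw [add_mul, one_mul]
    rw [sum_add_distrib, h3, add_zero]
  rw [h1, mul_sum, ← Equiv.sum_comp (Equiv.mulLeft₀ c hc)
    (fun y => (quadraticChar F c : ℂ) * ((quadraticChar F y : ℂ) * χ y))]
  refine sum_congr rfl fun y _ => ?_
  have h7 : (quadraticChar F c : ℂ) ^ 2 = 1 := by exact_mod_cast quadraticChar_sq_one hc
  simp only [Equiv.mulLeft₀_apply, map_mul]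
  push_cast
  linear_combination (-(quadraticChar F y : ℂ) * χ (c * y)) * h7

end SumValues

section SignConditions

variable {F : Type*} [Field F] [Fintype F]

lemma isSquare_iff_of_pow_sub_one_eq_neg_one (h2 : ringChar F ≠ 2) {P : ℕ} (hP : Odd P)
    (hF : Fintype.card F = P ^ 2) {w : F} (hw : w ≠ 0) (hwP : w ^ (P - 1) = -1) :
    IsSquare w ↔ P % 4 = 3 := by
  obtain ⟨k, rfl⟩ := hP
  have hdiv : Fintype.card F / 2 = (2 * k + 1 - 1) * (k + 1) := by
    rw [hF, Nat.add_sub_cancel, show (2 * k + 1) ^ 2 = 1 + 2 * (2 * k * (k + 1)) by ring,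
      Nat.add_mul_div_left _ _ (by norm_num)]
    simp
  rw [FiniteField.isSquare_iff h2 hw, hdiv, pow_mul, hwP]
  rcases Nat.even_or_odd k with hk | hk
  · rw [hk.add_one.neg_one_pow]
    obtain ⟨j, rfl⟩ := hk
    exact iff_of_false (Ring.neg_one_ne_one_of_char_ne_two h2) (by omega)
  · rw [hk.add_one.neg_one_pow]
    obtain ⟨j, rfl⟩ := hk
    exact iff_of_true rfl (by omega)

lemma exists_not_isSquare_pow_eq (h2 : ringChar F ≠ 2) {q ℓ : ℕ} (hq : Odd q) (hℓ : Odd ℓ)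
    (hF : Fintype.card F = q ^ ℓ) : ∃ s : F, s ≠ 0 ∧ s ^ q = s ∧ ¬IsSquare s := by
  obtain ⟨k, rfl⟩ := hq
  set E := ∑ i ∈ range ℓ, (2 * k + 1) ^ i with hE
  have hgeom : 2 * k * E + 1 = (2 * k + 1) ^ ℓ := by
    have := geom_sum_mul_add (2 * k) ℓ
    rw [← this, mul_comm]
  have hEodd : Odd E := by
    rw [hE, odd_sum_iff_odd_card_odd, filter_true_of_mem fun i _ => (odd_two_mul_add_one k).pow,
      card_range]
    exact hℓ
  obtain ⟨s, hs, hsk⟩ := exists_pow_eq_of_pow_eq_one (F := F) (d := k) (e := 2 * E) (t := -1)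
    (by rw [hF, ← hgeom, Nat.add_sub_cancel]; ring) (neg_ne_zero.2 one_ne_zero)
    (by rw [pow_mul, neg_one_sq, one_pow])
  refine ⟨s, hs, ?_, ?_⟩
  · rw [pow_succ, mul_comm 2 k, pow_mul, hsk, neg_one_sq, one_mul]
  · have hdiv : Fintype.card F / 2 = k * E := by
      rw [hF, ← hgeom]
      have : 2 * k * E = 2 * (k * E) := by ring
      omega
    rw [FiniteField.isSquare_iff h2 hs, hdiv, pow_mul, hsk, hEodd.neg_one_pow]
    exact Ring.neg_one_ne_one_of_char_ne_two h2

variable [DecidableEq F]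

lemma powSum_one_eq {χ : AddChar F ℂ} (hχ1 : χ ≠ 1) {P : ℕ} (hPodd : Odd P)
    (h2 : ringChar F ≠ 2) (hadd : ∀ x y : F, (x + y) ^ P = x ^ P + y ^ P)
    (hχ : ∀ x, χ (x ^ P) = χ x) (hF : Fintype.card F = P ^ 2) {a : F} (ha : a ≠ 0) :
    powSum χ 1 a = if (IsSquare a ↔ P % 4 = 3) then (P : ℂ) else -P := by
  have hP : 1 ≤ P := hPodd.pos
  obtain ⟨w, hw, hwP⟩ := exists_pow_eq_of_pow_eq_one (F := F) (d := P - 1) (e := P + 1) (t := -1)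
    (by rw [hF, mul_comm]; simpa using (Nat.sq_sub_sq P 1).symm) (neg_ne_zero.2 one_ne_zero)
    (by rw [hPodd.add_one.neg_one_pow])
  have hwP' : w ^ P = -w := by
    conv_lhs => rw [← Nat.sub_add_cancel hP]
    rw [pow_succ, hwP, neg_one_mul]
  obtain ⟨G, hG⟩ := exists_powSum_one_eq_quadraticChar_mul hχ1 h2
  have h1 := powSum_one_of_anti hχ1 hP (Ring.two_ne_zero h2) hadd hχ hF hw hwP'
  rw [hG w hw] at h1
  have hsq := isSquare_iff_of_pow_sub_one_eq_neg_one h2 hPodd hF hw hwP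
  rw [hG a ha]
  simp only [← hsq]
  by_cases hwS : IsSquare w <;> by_cases haS : IsSquare a
  · rw [(quadraticChar_one_iff_isSquare hw).2 hwS] at h1
    rw [(quadraticChar_one_iff_isSquare ha).2 haS]
    simpa [hwS, haS] using h1
  · rw [(quadraticChar_one_iff_isSquare hw).2 hwS] at h1
    rw [quadraticChar_neg_one_iff_not_isSquare.2 haS]
    simpa [hwS, haS] using h1
  · rw [quadraticChar_neg_one_iff_not_isSquare.2 hwS] at h1
    rw [(quadraticChar_one_iff_isSquare ha).2 haS]
    simp [hwS, haS, ← h1]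
  · rw [quadraticChar_neg_one_iff_not_isSquare.2 hwS] at h1
    rw [quadraticChar_neg_one_iff_not_isSquare.2 haS]
    simpa [hwS, haS] using h1

/-- If the twisted sums are large on average, the linearized map has a kernel of maximal size. -/
lemma le_card_ker_of_sum_powSum {χ : AddChar F ℂ} (hχ1 : χ ≠ 1) {Q q P : ℕ} (hQ : 1 ≤ Q)
    (hq : 2 ≤ q) (hadd : ∀ x y : F, (x + y) ^ Q = x ^ Q + y ^ Q) (hχ : ∀ x, χ (x ^ Q) = χ x)
    (hF : Fintype.card F = P ^ 2) (K : Finset F) (hK : #K = q - 1)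
    (hKQ : ∀ t ∈ K, t ≠ 0 ∧ t ^ Q = t) {a : F}
    (hsum : ∑ t ∈ K, powSum χ Q (t * a) = -(((q : ℂ) - 1) * (P * Q))) :
    Q ^ 2 ≤ #{x : F | a ^ Q * x ^ Q ^ 2 + a * x = 0} := by
  have hP : 0 < P := by
    have := Fintype.card_pos (α := F)
    rw [hF] at this
    exact pow_pos_iff two_ne_zero |>.1 this
  by_contra! hlt
  have hbound : ∀ t ∈ K, ‖powSum χ Q (t * a)‖ < (P * Q : ℝ) := by
    intro t ht
    obtain ⟨ht0, htQ⟩ := hKQ t ht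
    have h := norm_powSum_sq_le hχ1 hQ hadd hχ (t * a)
    have hker : ({x : F | (t * a) ^ Q * x ^ Q ^ 2 + t * a * x = 0} : Finset F)
        = ({x : F | a ^ Q * x ^ Q ^ 2 + a * x = 0} : Finset F) := by
      ext x
      simp only [mem_filter, mem_univ, true_and]
      rw [mul_pow, htQ, show t * a ^ Q * x ^ Q ^ 2 + t * a * x
        = t * (a ^ Q * x ^ Q ^ 2 + a * x) by ring, mul_eq_zero, or_iff_right ht0]
    rw [hker, hF] at h
    refine lt_of_pow_lt_pow_left₀ 2 (by positivity) (h.trans_lt ?_)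
    rw [mul_pow]
    push_cast
    gcongr
    exact_mod_cast hlt
  have hne : K.Nonempty := card_pos.1 (by omega)
  have h1 := (norm_sum_le K _).trans_lt (sum_lt_sum_of_nonempty hne hbound)
  rw [hsum, sum_const, hK, nsmul_eq_mul, norm_neg, norm_mul, norm_mul, Complex.norm_natCast,
    Complex.norm_natCast, show (q : ℂ) - 1 = ((q - 1 : ℕ) : ℂ) by
      rw [Nat.cast_sub (by omega), Nat.cast_one], Complex.norm_natCast] at h1
  exact lt_irrefl _ h1

lemma dvd_of_le_card_twisted_ker {q ℓ k Q : ℕ} (hq : 2 ≤ q) (hk : 1 ≤ k)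
    (hF : Fintype.card F = q ^ ℓ) (hQ : Q ^ 2 = q ^ k) {a x₀ : F} (ha : a ≠ 0) (hx₀ : x₀ ≠ 0)
    (h0 : a ^ Q * x₀ ^ Q ^ 2 + a * x₀ = 0)
    (hle : Q ^ 2 ≤ #{x : F | a ^ Q * x ^ Q ^ 2 + a * x = 0}) : k ∣ ℓ := by
  rw [card_twisted_ker hx₀ ha h0, hQ, card_pow_eq_self (Nat.one_le_pow _ _ (by omega)), hF,
    Nat.pow_sub_one_gcd_pow_sub_one, Nat.sub_add_cancel (Nat.one_le_pow _ _ (by omega))] at hle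
  have h := (Nat.pow_le_pow_iff_right (by omega)).1 hle
  have h' := Nat.le_antisymm (Nat.le_of_dvd hk (Nat.gcd_dvd_right ℓ k)) h
  rw [← h']
  exact Nat.gcd_dvd_left ℓ k

end SignConditions

/-- Let `p` be prime, `q = p ^ n`, `ℓ ≥ 2`, `r ≥ 0` with `nℓ` even.
Let `a, b, c ∈ F_{q^ℓ}` with `a ≠ 0`, `f(x) = a^(q^r) x^(q^(2r)) + a x`, and suppose there
is `x₀` with `f(x₀) = -b^(q^r)` and `T(a x₀^(q^r+1) - c) = 0`.  Then
`N_{ℓ,r}(a,b,c) = q^ℓ - (q-1) p^(nℓ/2 + nr)` (minimality) iff one of the conditions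
(1′), (2′), (3′) holds. -/
theorem stmt_13 (p n : ℕ) (hp : p.Prime) (hn : 1 ≤ n) (q : ℕ) (hq : q = p ^ n)
    (ℓ r : ℕ) (hℓ : 2 ≤ ℓ) (hnl : Even (n * ℓ))
    (F : Type) [Field F] [Fintype F] (hF : Fintype.card F = q ^ ℓ)
    (T : F → F) (hT : ∀ z : F, T z = ∑ i ∈ Finset.range ℓ, z ^ q ^ i)
    (a b c : F) (ha : a ≠ 0)
    (hsol : ∃ x₀ : F, a ^ q ^ r * x₀ ^ q ^ (2 * r) + a * x₀ = -(b ^ q ^ r) ∧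
      T (a * x₀ ^ (q ^ r + 1) - c) = 0) :
    ((Nat.card {xy : F × F //
        xy.2 ^ q - xy.2 = a * xy.1 ^ (q ^ r + 1) + b * xy.1 + c} : ℤ)
      = (q : ℤ) ^ ℓ - ((q : ℤ) - 1) * (p : ℤ) ^ (n * ℓ / 2 + n * r))
    ↔ ((r = 0 ∧ Even ℓ ∧ p % 4 = 1 ∧ IsSquare a) ∨
       (r = 0 ∧ Even ℓ ∧ p % 4 = 3 ∧
         ((Odd (n * ℓ / 2) ∧ ¬IsSquare a) ∨ (Even (n * ℓ / 2) ∧ IsSquare a))) ∨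
       (1 ≤ r ∧ (2 * r) ∣ ℓ ∧ Even (ℓ / (2 * r)) ∧
         ¬Function.Bijective (fun x : F => a ^ q ^ r * x ^ q ^ (2 * r) + a * x))) := by
  have : DecidableEq F := Classical.decEq F
  have : Fact p.Prime := ⟨hp⟩
  have hFp : Fintype.card F = p ^ (n * ℓ) := by rw [hF, hq, pow_mul]
  have : CharP F p := charP_of_card_eq_prime_pow hFp
  have hq2 : 2 ≤ q := by
    rw [hq]
    exact hp.two_le.trans (Nat.le_self_pow (by omega) p)
  have hadd : ∀ x y : F, (x + y) ^ q = x ^ q + y ^ q := by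
    intro x y
    rw [hq, add_pow_char_pow]
  obtain ⟨χ, hχ1, hχ, hχT⟩ := exists_addChar_trace hq2 (by omega) hF hadd
  obtain ⟨x₀, hx₀, hTx₀⟩ := hsol
  set P := p ^ (n * ℓ / 2) with hPdef
  set Q := q ^ r with hQdef
  have hQ1 : 1 ≤ Q := Nat.one_le_pow _ _ (by omega)
  have haddQ := add_pow_pow_of_add_pow hadd r
  have hχQ := addChar_pow_pow hχ r
  have hFP : Fintype.card F = P ^ 2 := by
    rw [hFp, hPdef, ← pow_mul, Nat.div_mul_cancel hnl.two_dvd]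
  have hQ2 : q ^ (2 * r) = Q ^ 2 := by rw [hQdef, ← pow_mul, mul_comm]
  rw [hQ2] at hx₀
  simp only [hQ2]
  have hfixQ : ∀ t : F, t ^ q = t → t ^ Q = t := fun t ht => pow_pow_eq_self ht r
  set K : Finset F := ({t : F | t ^ q = t} : Finset F).erase 0 with hKdef
  have hmemK : ∀ t, t ∈ K ↔ t ≠ 0 ∧ t ^ q = t := by simp [hKdef]
  have hKcard : #K = q - 1 := by
    have hfix := card_pow_eq_self (F := F) (Q := q) (by omega)
    rw [hF, Nat.gcd_eq_right (Nat.sub_one_dvd_pow_sub_one q ℓ)] at hfix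
    rw [hKdef, card_erase_of_mem (by simp; omega), hfix, Nat.add_sub_cancel]
  have hN : (Nat.card {xy : F × F //
        xy.2 ^ q - xy.2 = a * xy.1 ^ (Q + 1) + b * xy.1 + c} : ℂ)
      = (q : ℂ) ^ ℓ + ∑ t ∈ K, powSum χ Q (t * a) := by
    rw [card_artinSchreier hχ1 (by omega) hadd hχ (fun x => a * x ^ (Q + 1) + b * x + c),
      sum_congr rfl fun t ht => sum_addChar_translate haddQ hχQ
        (hfixQ t (mem_filter.1 ht).2) hx₀
        (hχT _ (by rw [← hT]; exact hTx₀) t (mem_filter.1 ht).2),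
      ← add_sum_erase _ _ (show (0 : F) ∈ ({t : F | t ^ q = t} : Finset F) by simp; omega)]
    congr 1
    simp [powSum, hF]
  have hred : ((Nat.card {xy : F × F //
        xy.2 ^ q - xy.2 = a * xy.1 ^ (Q + 1) + b * xy.1 + c} : ℤ)
      = (q : ℤ) ^ ℓ - ((q : ℤ) - 1) * (p : ℤ) ^ (n * ℓ / 2 + n * r))
      ↔ ∑ t ∈ K, powSum χ Q (t * a) = -(((q : ℂ) - 1) * (P * Q)) := by
    rw [← Int.cast_inj (α := ℂ)]
    push_cast
    rw [hN, sub_eq_add_neg ((q : ℂ) ^ ℓ), add_right_inj, hPdef, hQdef, hq, ← pow_mul, pow_add]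
    push_cast
    rfl
  rw [hred]
  have hPQ : (P * Q : ℂ) ≠ 0 := by
    have : 0 < p := hp.pos
    have hP0 : P ≠ 0 := by positivity
    have hQ0 : Q ≠ 0 := by omega
    exact_mod_cast mul_ne_zero hP0 hQ0
  have hq1 : (q : ℂ) - 1 ≠ 0 := by
    rw [sub_ne_zero]
    exact_mod_cast (by omega : q ≠ 1)
  have hconst : ∀ S : ℂ, (∀ t ∈ K, powSum χ Q (t * a) = S) →
      (∑ t ∈ K, powSum χ Q (t * a) = -(((q : ℂ) - 1) * (P * Q)) ↔ S = -(P * Q)) := by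
    intro S hS
    rw [sum_congr rfl hS, sum_const, hKcard, nsmul_eq_mul, Nat.cast_sub (by omega), Nat.cast_one,
      ← mul_neg]
    exact mul_right_inj' hq1
  rcases Nat.eq_zero_or_pos r with hr | hr
  · have hQone : Q = 1 := by rw [hQdef, hr, pow_zero]
    have hzero : (∀ S : ℂ, S = 0 → ¬ S = -(((q : ℂ) - 1) * (P * Q))) := by
      rintro S rfl h
      exact neg_ne_zero.2 (mul_ne_zero hq1 hPQ) h.symm
    rcases hp.eq_two_or_odd' with hp2 | hpodd
    · refine iff_of_false (hzero _ (sum_eq_zero fun t ht => ?_)) (by omega)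
      have hadd2 : ∀ x y : F, (x + y) ^ 2 = x ^ 2 + y ^ 2 := by
        intro x y
        have := add_pow_char_pow (p := p) (n := 1) x y
        rwa [pow_one, hp2] at this
      have hta : t * a ≠ 0 := mul_ne_zero ((hmemK t).1 ht).1 ha
      rw [hQone, powSum, one_add_one_eq_two, (bijective_pow_of_add_pow one_le_two hadd2).sum_comp
        (fun y => χ (t * a * y))]
      simp_rw [mul_comm (t * a)]
      rw [AddChar.sum_mulShift _ (AddChar.IsPrimitive.of_ne_one hχ1), if_neg hta, Nat.cast_zero]
    have hringChar : ringChar F ≠ 2 := by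
      rw [ringChar.eq F p]
      rintro rfl
      exact absurd hpodd (by decide)
    have hqodd : Odd q := by rw [hq]; exact hpodd.pow
    rcases Nat.even_or_odd ℓ with hℓe | hℓo
    · obtain ⟨j, hj⟩ := hℓe
      have hPq : P = q ^ j := by
        rw [hPdef, hq, ← pow_mul, hj, ← two_mul, Nat.mul_left_comm, Nat.mul_div_cancel_left _ two_pos]
      have hPodd : Odd P := by rw [hPq]; exact hqodd.pow
      have hsum : ∀ t ∈ K, powSum χ Q (t * a) = powSum χ 1 a := by
        intro t ht
        obtain ⟨ht0, htq⟩ := (hmemK t).1 ht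
        obtain ⟨z, hz, hzt⟩ := exists_pow_succ_eq (m := 1) hPodd.pos (by rw [hFP, pow_one]) ht0
          (by rw [hPq]; exact pow_pow_eq_self htq j)
        obtain ⟨i, hi⟩ := hPodd.add_one
        rw [hQone, ← powSum_mul_pow χ 1 a (pow_ne_zero i hz), ← pow_mul, ← hzt, hi, mul_comm]
        congr 3
        ring
      rw [hconst _ hsum, powSum_one_eq hχ1 hPodd hringChar
        (by rw [hPq]; exact add_pow_pow_of_add_pow hadd j)
        (by rw [hPq]; exact addChar_pow_pow hχ j) hFP ha, hQone, Nat.cast_one, mul_one]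
      have hP0 : (P : ℂ) ≠ -P := by
        rw [ne_eq, self_eq_neg]
        exact_mod_cast hPodd.pos.ne'
      have hiff : ((if (IsSquare a ↔ P % 4 = 3) then (P : ℂ) else -P) = -P)
          ↔ ¬(IsSquare a ↔ P % 4 = 3) := by
        split_ifs with h
        · exact iff_of_false hP0 (not_not.2 h)
        · exact iff_of_true rfl h
      rw [hiff]
      have hℓ2 : Even ℓ := ⟨j, hj⟩
      have hr1 : ¬ 1 ≤ r := by omega
      simp only [hr, hℓ2, true_and, hPdef]
      have hp4 : p % 4 = 1 ∨ p % 4 = 3 := Nat.odd_mod_four_iff.1 (Nat.odd_iff.1 hpodd)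
      rcases hp4 with h4 | h4
      · have hP4 : p ^ (n * ℓ / 2) % 4 = 1 := by simp [Nat.pow_mod, h4]
        simp [h4, hP4]
      · rcases Nat.even_or_odd (n * ℓ / 2) with hk | hk
        · have hP4 : p ^ (n * ℓ / 2) % 4 = 1 := by
            obtain ⟨i, hi⟩ := hk
            rw [hi, ← two_mul, pow_mul, Nat.pow_mod, Nat.pow_mod p 2, h4]
            simp
          have hk' : ¬ Odd (n * ℓ / 2) := Nat.not_odd_iff_even.2 hk
          simp [h4, hP4, hk, hk']
        · have hP4 : p ^ (n * ℓ / 2) % 4 = 3 := by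
            obtain ⟨i, hi⟩ := hk
            rw [hi, pow_succ, pow_mul, Nat.mul_mod, Nat.pow_mod, Nat.pow_mod p 2, h4]
            simp
          have hk' : ¬ Even (n * ℓ / 2) := Nat.not_even_iff_odd.2 hk
          simp [h4, hP4, hk, hk']
    · have hℓ2 : ¬ Even ℓ := Nat.not_even_iff_odd.2 hℓo
      refine iff_of_false (hzero _ ?_) (by
        rintro (h | h | h)
        · exact hℓ2 h.2.1
        · exact hℓ2 h.2.1
        · omega)
      obtain ⟨s, hs, hsq, hsn⟩ := exists_not_isSquare_pow_eq hringChar hqodd hℓo hF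
      obtain ⟨G, hG⟩ := exists_powSum_one_eq_quadraticChar_mul hχ1 hringChar
      have hflip : ∑ t ∈ K, powSum χ Q (t * a) = ∑ t ∈ K, -powSum χ Q (t * a) := by
        refine (sum_bij' (fun t _ => s * t) (fun t _ => s⁻¹ * t) ?_ ?_ ?_ ?_ ?_).symm
        · intro t ht
          obtain ⟨ht0, htq⟩ := (hmemK t).1 ht
          exact (hmemK _).2 ⟨mul_ne_zero hs ht0, by rw [mul_pow, hsq, htq]⟩
        · intro t ht
          obtain ⟨ht0, htq⟩ := (hmemK t).1 ht
          exact (hmemK _).2 ⟨mul_ne_zero (inv_ne_zero hs) ht0, by rw [mul_pow, inv_pow, hsq, htq]⟩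
        · intro t _; field_simp
        · intro t _; field_simp
        · intro t ht
          obtain ⟨ht0, htq⟩ := (hmemK t).1 ht
          have hta := mul_ne_zero ht0 ha
          rw [hQone, mul_assoc, hG _ hta, hG _ (mul_ne_zero hs hta), map_mul _ s,
            quadraticChar_neg_one_iff_not_isSquare.2 hsn]
          push_cast
          ring
      rw [sum_neg_distrib, self_eq_neg] at hflip
      exact hflip
  · have hQ2le : 2 ≤ Q := hq2.trans (Nat.le_self_pow (by omega) q)
    have hval : ∀ x₁ : F, x₁ ≠ 0 → a ^ Q * x₁ ^ Q ^ 2 + a * x₁ = 0 → 2 * r ∣ ℓ →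
        (∑ t ∈ K, powSum χ Q (t * a) = -(((q : ℂ) - 1) * (P * Q)) ↔ Even (ℓ / (2 * r))) := by
      rintro x₁ hx₁ hker ⟨m, hm⟩
      have hFm : Fintype.card F = (Q ^ 2) ^ m := by rw [hF, hm, pow_mul, hQ2]
      have hPm : P = Q ^ m := by
        refine Nat.pow_left_injective two_ne_zero ?_
        change P ^ 2 = (Q ^ m) ^ 2
        exact hFP.symm.trans (hFm.trans (pow_right_comm Q 2 m))
      have hanti : ∀ w : F, w ^ Q = -w → χ w = 1 := by
        intro w hw
        rw [← one_mul w]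
        refine hχT w ?_ 1 (one_pow q)
        rw [hm]
        refine sum_range_two_mul_mul_eq_zero (fun i => ?_) m
        rw [add_comm, pow_add, pow_mul, ← hQdef, hw, neg_pow,
          neg_one_pow_of_add_pow (Nat.one_le_pow _ _ (by omega))
            (add_pow_pow_of_add_pow hadd i), neg_one_mul]
      have hsum : ∀ t ∈ K, powSum χ Q (t * a) = powSum χ Q a := by
        intro t ht
        obtain ⟨ht0, htq⟩ := (hmemK t).1 ht
        obtain ⟨z, hz, hzt⟩ := exists_pow_succ_eq hQ1 hFm ht0 (hfixQ t htq)
        rw [← powSum_mul_pow χ Q a hz, hzt, mul_comm]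
      have hPQm : (P * Q : ℂ) = (Q : ℂ) ^ (m + 1) := by
        rw [hPm, pow_succ]; push_cast; rfl
      rw [hconst _ hsum, powSum_eq_of_mem_ker hχ1 hQ2le haddQ hχQ hFm hanti ha hx₁ hker, ← hPQm,
        hm, Nat.mul_div_cancel_left m (by omega)]
      rcases Nat.even_or_odd m with he | ho
      · rw [he.add_one.neg_one_pow]
        exact iff_of_true (by ring) he
      · rw [ho.add_one.neg_one_pow, one_mul, self_eq_neg]
        exact iff_of_false hPQ (Nat.not_even_iff_odd.2 ho)
    have hr0 : r ≠ 0 := by omega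
    simp only [hr0, false_and, false_or]
    constructor
    · intro h
      have hle := le_card_ker_of_sum_powSum hχ1 hQ1 hq2 haddQ hχQ hFP K hKcard
        (fun t ht => ⟨((hmemK t).1 ht).1, hfixQ t ((hmemK t).1 ht).2⟩) h
      obtain ⟨x₁, hx₁, hne⟩ := exists_mem_ne (lt_of_lt_of_le (by nlinarith) hle) (0 : F)
      replace hx₁ := (mem_filter.1 hx₁).2
      have hdvd := dvd_of_le_card_twisted_ker hq2 (by omega) hF hQ2.symm ha hne hx₁ hle
      refine ⟨hr, hdvd, (hval x₁ hne hx₁ hdvd).1 h, fun hbij => hne (hbij.1 ?_)⟩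
      simp only
      rw [hx₁, mul_zero, zero_pow (by positivity), mul_zero, add_zero]
    · rintro ⟨-, hdvd, heven, hnot⟩
      have hninj : ¬ Function.Injective (fun x : F => a ^ Q * x ^ Q ^ 2 + a * x) :=
        fun h => hnot (Finite.injective_iff_bijective.1 h)
      simp only [Function.Injective, not_forall] at hninj
      obtain ⟨x, y, hxy, hne⟩ := hninj
      have hadd2 := add_pow_pow_of_add_pow hadd (2 * r) (x - y) y
      rw [sub_add_cancel, hQ2] at hadd2
      exact (hval (x - y) (sub_ne_zero.2 hne)
        (by linear_combination hxy - a ^ Q * hadd2) hdvd).2 heven
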